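/- Let q ≥ 2 and n ≥ 2 be natural numbers, let F be a finite field with exactly q^n elements, and let g be a generator of the cyclic multiplicative group F^×. Then g^{nq+1} ≠ g^{n+1}; equivalently g^{n(q-1)} ≠ 1. -/

import Mathlib

theorem one_add_mul_lt_succ_pow {r n : ℕ} (hr : 1 ≤ r) (hn : 2 ≤ n) :
    1 + n * r < (r + 1) ^ n := by
  induction n, hn using Nat.le_induction with
  | base => nlinarith
  | succ k _ ih =>
    rw [pow_succ]
    nlinarith [Nat.mul_le_mul_right (r + 1) ih.le, Nat.mul_le_mul_left k (Nat.mul_le_mul hr hr)]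


/-- Let `q ≥ 2` and `n ≥ 2` be natural numbers, `F` a finite field with `q^n` elements,
and `g` a generator of the cyclic multiplicative group `Fˣ`. Then
`g^{nq+1} ≠ g^{n+1}`; equivalently `g^{n(q-1)} ≠ 1`. -/
theorem generator_pow_ne (q n : ℕ) (hq : 2 ≤ q) (hn : 2 ≤ n)
    (F : Type*) [Field F] [Fintype F] (hcard : Fintype.card F = q ^ n)
    (g : Fˣ) (hg : ∀ x : Fˣ, x ∈ Subgroup.zpowers g) :
    g ^ (n * q + 1) ≠ g ^ (n + 1) ∧ g ^ (n * (q - 1)) ≠ 1 := by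
  obtain ⟨r, rfl⟩ : ∃ r, q = r + 1 := ⟨q - 1, by omega⟩
  have hr : 1 ≤ r := by omega
  have hord : orderOf g = (r + 1) ^ n - 1 := by
    rw [orderOf_eq_card_of_forall_mem_zpowers hg, Nat.card_units, Nat.card_eq_fintype_card, hcard]
  have hne : g ^ (n * r) ≠ 1 := by
    refine pow_ne_one_of_lt_orderOf (by positivity) ?_
    have := one_add_mul_lt_succ_pow hr hn
    omega
  refine ⟨fun h => hne ?_, hne⟩
  rw [show n * (r + 1) + 1 = n * r + (n + 1) by ring, pow_add] at h
  exact mul_eq_right.mp h
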